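/- Let P be a polynomial of degree d ≥ 2 with coefficients in K, and let O ⊆ K be a cycle of P with multiplier λ. Suppose λ ≠ 0 and that either (#O ≤ 2d−2 and |λ| < λ(d)^{d·#O}) or (#O > 2d−2 and |λ| < λ(d)^{#O + 2(d−1)²}). Then there exists c ∈ K with P'(c) = 0 such that the forward orbit of c is infinite (the points P^n(c), n ≥ 0, are pairwise distinct) and the sequence (P^{n·#O}(c))_{n≥1} converges to a point of O. (This is Theorem B of the paper in the case of a polynomial map and a cycle contained in K; the hypothesis is the multiplicative form of the condition −∞ < χ < d·log λ(d), resp. χ < (1 + 2(d−1)²/#O)·log λ(d), on the Lyapunov exponent χ = (1/#O) log|λ|.) -/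

import Mathlib

/-!
STATEMENT 2 (Theorem B, polynomial case): Let `P` be a polynomial of degree `d ≥ 2` over
`K` and `O` a cycle of `P` of period `N` with multiplier `λ ≠ 0`.  If either
`N ≤ 2d − 2` and `‖λ‖ < lam K d ^ (d·N)`, or `N > 2d − 2` and
`‖λ‖ < lam K d ^ (N + 2(d−1)²)`, then `P` has a critical point `c` with infinite forward
orbit attracted to `O`.
-/

open Polynomial Filter

/-- `lam K d = min {‖(m : K)‖ : m ∈ {1, …, d}}`. -/
noncomputable def lam (K : Type*) [NormedField K] (d : ℕ) : ℝ :=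
  ⨅ m : Finset.Icc 1 d, ‖((m : ℕ) : K)‖

section one
set_option linter.unusedSectionVars false
set_option linter.unusedSimpArgs false
variable {K : Type*} [NontriviallyNormedField K] [IsAlgClosed K] [IsUltrametricDist K]

theorem lam_le {d m : ℕ} (h1 : 1 ≤ m) (h2 : m ≤ d) : lam K d ≤ ‖(m : K)‖ := by
  unfold lam
  exact ciInf_le (f := fun m : Finset.Icc 1 d => ‖((m : ℕ) : K)‖)
    (Set.finite_range _).bddBelow ⟨m, Finset.mem_Icc.2 ⟨h1, h2⟩⟩

theorem lam_le_one {d : ℕ} (h : 1 ≤ d) : lam K d ≤ 1 := by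
  simpa using lam_le (K := K) (le_refl 1) h

theorem lam_nonneg (d : ℕ) : 0 ≤ lam K d := Real.iInf_nonneg fun _ => norm_nonneg _

/-- product form of the Gauss norm -/
noncomputable def Phi (H : K[X]) (r : ℝ) : ℝ :=
  ‖H.leadingCoeff‖ * (H.roots.map (fun w => max r ‖w‖)).prod

theorem Phi_eq_gauss (H : K[X]) {r : ℝ} (hr : 0 < r) :
    Phi H r = H.gaussNorm (NormedField.toAbsoluteValue K) r := by
  have hna : IsNonarchimedean (NormedField.toAbsoluteValue K) := fun x y =>
    IsUltrametricDist.norm_add_le_max x y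
  have hlin : ∀ w : K, (X - C w).gaussNorm (NormedField.toAbsoluteValue K) r = max r ‖w‖ := by
    intro w
    apply le_antisymm
    · obtain ⟨i, hi⟩ := exists_eq_gaussNorm (NormedField.toAbsoluteValue K) r (X - C w)
      rw [hi]
      rcases i with _ | _ | i
      · simp [NormedField.toAbsoluteValue]
      · simp [NormedField.toAbsoluteValue, coeff_C]
      · simp [NormedField.toAbsoluteValue, coeff_X, coeff_C, hr.le]
    · apply max_le
      · have := le_gaussNorm (NormedField.toAbsoluteValue K) (X - C w) hr.le 1
        simpa [NormedField.toAbsoluteValue, coeff_C] using this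
      · have := le_gaussNorm (NormedField.toAbsoluteValue K) (X - C w) hr.le 0
        simpa [NormedField.toAbsoluteValue] using this
  have hprod : ∀ S : Multiset K, ((S.map (fun w => X - C w)).prod).gaussNorm
      (NormedField.toAbsoluteValue K) r = (S.map (fun w => max r ‖w‖)).prod := by
    intro S
    induction S using Multiset.induction_on with
    | empty => 
      have := gaussNorm_C (NormedField.toAbsoluteValue K) r (1:K)
      simpa using this
    | cons a S ih =>
      rw [Multiset.map_cons, Multiset.prod_cons, gaussNorm_mul hna hr, hlin, ih,
        Multiset.map_cons, Multiset.prod_cons]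
  conv_rhs => rw [(IsAlgClosed.splits H).eq_prod_roots]
  rw [gaussNorm_mul hna hr, hprod, gaussNorm_C]
  rfl

theorem eval_le_Phi (H : K[X]) {r : ℝ} {z : K} (hz : ‖z‖ ≤ r) : ‖H.eval z‖ ≤ Phi H r := by
  rw [(IsAlgClosed.splits H).eval_eq_prod_roots, norm_mul, Phi]
  gcongr
  generalize H.roots = S
  induction S using Multiset.induction_on with
  | empty => simp
  | cons a S ih =>
    simp only [Multiset.map_cons, Multiset.prod_cons, norm_mul]
    gcongr
    have h := IsUltrametricDist.norm_add_le_max z (-a)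
    rw [norm_neg, ← sub_eq_add_neg] at h
    exact h.trans (max_le_max hz le_rfl)

open Classical in
/-- the product of `r/|w|` over small roots -/
noncomputable def Aprod (S : Multiset K) (r : ℝ) : ℝ :=
  ((S.filter (fun w => ‖w‖ < r)).map (fun w => r / ‖w‖)).prod

theorem Phi_eq (H : K[X]) (h0 : H.eval 0 ≠ 0) (r : ℝ) :
    Phi H r = ‖H.eval 0‖ * Aprod H.roots r := by
  have hne : ∀ w ∈ H.roots, w ≠ 0 := by
    rintro w hw rfl
    exact h0 (mem_roots'.1 hw).2
  rw [(IsAlgClosed.splits H).eval_eq_prod_roots, norm_mul, Phi, mul_assoc]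
  congr 1
  revert hne
  generalize H.roots = S
  unfold Aprod
  induction S using Multiset.induction_on with
  | empty => simp
  | cons a S ih =>
    intro hne
    have ih := ih (fun w hw => hne w (Multiset.mem_cons_of_mem hw))
    have ha : ‖a‖ ≠ 0 := norm_ne_zero_iff.2 (hne a (Multiset.mem_cons_self a S))
    simp only [Multiset.map_cons, Multiset.prod_cons, norm_mul]
    rw [ih]
    by_cases h : ‖a‖ < r
    · rw [Multiset.filter_cons_of_pos (p := fun w : K => ‖w‖ < r) S h, Multiset.map_cons, Multiset.prod_cons, max_eq_left h.le]
      simp only [zero_sub, norm_neg]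
      field_simp
    · rw [Multiset.filter_cons_of_neg (p := fun w : K => ‖w‖ < r) S h, max_eq_right (not_lt.1 h)]
      simp only [zero_sub, norm_neg]
      ring

theorem deriv_Phi (Q : K[X]) {r : ℝ} (hr : 0 < r) {d : ℕ} (hd : Q.natDegree ≤ d)
    (h0 : Q.eval 0 = 0) :
    lam K d * Phi Q r ≤ r * Phi (derivative Q) r := by
  rw [Phi_eq_gauss _ hr, Phi_eq_gauss _ hr]
  obtain ⟨i, hi⟩ := exists_eq_gaussNorm (NormedField.toAbsoluteValue K) r Q
  rw [hi]
  have hv : ∀ x : K, NormedField.toAbsoluteValue K x = ‖x‖ := fun _ => rfl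
  rcases i with _ | i
  · rw [coeff_zero_eq_eval_zero, h0, hv]
    simp only [norm_zero, zero_mul, mul_zero]
    exact mul_nonneg hr.le (gaussNorm_nonneg _ _ hr.le)
  · by_cases hc : Q.coeff (i+1) = 0
    · rw [hc]
      simp only [map_zero, zero_mul, mul_zero]
      exact mul_nonneg hr.le (gaussNorm_nonneg _ _ hr.le)
    have hle : i + 1 ≤ d := (le_natDegree_of_ne_zero hc).trans hd
    have h1 := le_gaussNorm (NormedField.toAbsoluteValue K) (derivative Q) hr.le i
    rw [coeff_derivative, hv, norm_mul] at h1
    have h2 : lam K d ≤ ‖((i:K)+1)‖ := by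
      have := lam_le (K := K) (Nat.succ_pos i) hle
      simpa using this
    rw [hv]
    calc lam K d * (‖Q.coeff (i+1)‖ * r^(i+1)) ≤ ‖((i:K)+1)‖ * (‖Q.coeff (i+1)‖ * r^(i+1)) := by
          gcongr
      _ = r * (‖Q.coeff (i+1)‖ * ‖((i:K)+1)‖ * r^i) := by ring
      _ ≤ _ := by gcongr

theorem Aprod_one_le (S : Multiset K) (h0 : ∀ w ∈ S, w ≠ 0) (r : ℝ) : 1 ≤ Aprod S r := by
  unfold Aprod
  induction S using Multiset.induction_on with
  | empty => simp
  | cons a S ih =>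
    have ih := ih (fun w hw => h0 w (Multiset.mem_cons_of_mem hw))
    have ha : 0 < ‖a‖ := norm_pos_iff.2 (h0 a (Multiset.mem_cons_self a S))
    by_cases h : ‖a‖ < r
    · rw [Multiset.filter_cons_of_pos (p := fun w : K => ‖w‖ < r) S h, Multiset.map_cons, Multiset.prod_cons]
      exact one_le_mul_of_one_le_of_one_le ((one_le_div ha).2 h.le) ih
    · rwa [Multiset.filter_cons_of_neg (p := fun w : K => ‖w‖ < r) S h]

theorem Aprod_add (S T : Multiset K) (r : ℝ) : Aprod (S + T) r = Aprod S r * Aprod T r := by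
  simp [Aprod]

theorem Aprod_nsmul (n : ℕ) (S : Multiset K) (r : ℝ) : Aprod (n • S) r = Aprod S r ^ n := by
  simp [Aprod, Multiset.filter_nsmul, Multiset.map_nsmul, Multiset.prod_nsmul]

open Classical in
/-- The factors only depend on the small roots, so we compare filtered multisets. -/
theorem Aprod_mono {r : ℝ} {S T : Multiset K} (h : S.filter (‖·‖ < r) ≤ T.filter (‖·‖ < r))
    (h0 : ∀ w ∈ T, w ≠ 0) : Aprod S r ≤ Aprod T r := by
  obtain ⟨U, hU⟩ := Multiset.le_iff_exists_add.1 h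
  have hUT : ∀ w ∈ U, w ∈ T ∧ ‖w‖ < r := by
    intro w hw
    have : w ∈ T.filter (‖·‖ < r) := by rw [hU]; exact Multiset.mem_add.2 (Or.inr hw)
    exact Multiset.mem_filter.1 this
  have hS : Aprod T r = Aprod S r * Aprod U r := by
    rw [← Aprod_add]
    unfold Aprod
    rw [hU, Multiset.filter_add, Multiset.filter_eq_self.2 (fun w hw => (hUT w hw).2)]
  have hS1 : 0 ≤ Aprod S r := by
    unfold Aprod
    apply Multiset.prod_nonneg
    intro a ha
    obtain ⟨w, hw, rfl⟩ := Multiset.mem_map.1 ha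
    have := (Multiset.mem_filter.1 hw).2
    exact div_nonneg ((norm_nonneg w).trans this.le) (norm_nonneg w)
  rw [hS]
  exact le_mul_of_one_le_right hS1 (Aprod_one_le U (fun w hw => h0 w (hUT w hw).1) r)

open Classical in
theorem step0 (Q : K[X]) (d : ℕ) (hd : 2 ≤ d) (hdeg : Q.natDegree = d) (h0 : Q.eval 0 = 0)
    (h1 : Q.derivative.eval 0 ≠ 0) (hlam : 0 < lam K d) {s : ℝ} (hs : 0 < s) :
    ∃ r : ℝ, 0 < r ∧ (∀ z, ‖z‖ < r → ‖Q.eval z‖ < s) ∧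
      ((∀ c, ‖c‖ < r → Q.derivative.eval c = 0 → Q.eval c = 0) →
        (∀ w, w ≠ 0 → ‖w‖ < r → Q.eval w = 0 → lam K d * r ≤ ‖w‖) ∧
        lam K d ^ (d - 1) * s ≤ ‖Q.derivative.eval 0‖ * r) ∧
      ((∀ c, ‖c‖ < r → Q.derivative.eval c ≠ 0) →
        lam K d * s ≤ ‖Q.derivative.eval 0‖ * r) := by
  obtain ⟨H, hH⟩ : ∃ H : K[X], Q = X * H := by
    refine ⟨Q.divX, ?_⟩
    conv_lhs => rw [← divX_mul_X_add Q]
    rw [coeff_zero_eq_eval_zero, h0]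
    simp [mul_comm]
  have hQ0 : Q ≠ 0 := by rintro rfl; simp at hdeg; omega
  have hH0 : H ≠ 0 := by rintro rfl; simp at hH; exact hQ0 hH
  have hHe : H.eval 0 = Q.derivative.eval 0 := by rw [hH]; simp
  have hHne : H.eval 0 ≠ 0 := by rw [hHe]; exact h1
  have hHdeg : H.natDegree = d - 1 := by
    have : Q.natDegree = 1 + H.natDegree := by rw [hH, natDegree_mul X_ne_zero hH0, natDegree_X]
    omega
  have hroots : Q.roots = {0} + H.roots := by
    rw [hH, roots_mul (by rw [← hH]; exact hQ0), roots_X]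
  have hPhi : ∀ r, 0 < r → Phi Q r = r * Phi H r := by
    intro r hr
    unfold Phi
    rw [hroots, hH, leadingCoeff_mul, leadingCoeff_X]
    simp [hr.le]
    ring
  have hHr : ∀ w ∈ H.roots, w ≠ 0 := by
    rintro w hw rfl
    exact hHne (mem_roots'.1 hw).2
  have hPhiH : ∀ r, Phi H r = ‖Q.derivative.eval 0‖ * Aprod H.roots r := by
    intro r; rw [Phi_eq H hHne, hHe]
  have ha : 0 < ‖Q.derivative.eval 0‖ := norm_pos_iff.2 h1
  have hPhiHge : ∀ r, ‖Q.derivative.eval 0‖ ≤ Phi H r := by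
    intro r; rw [hPhiH]
    exact le_mul_of_one_le_right ha.le (Aprod_one_le _ hHr r)
  -- existence of r
  obtain ⟨r, hr, hrs⟩ : ∃ r, 0 < r ∧ r * Phi H r = s := by
    have hcont : Continuous (fun r => r * Phi H r) := by
      have : Continuous (fun r : ℝ => (H.roots.map (fun w => max r ‖w‖)).prod) :=
        continuous_multiset_prod _ (fun w _ => by fun_prop)
      unfold Phi
      fun_prop
    have hb : s ≤ (s / ‖Q.derivative.eval 0‖) * Phi H (s / ‖Q.derivative.eval 0‖) := by
      calc s = (s / ‖Q.derivative.eval 0‖) * ‖Q.derivative.eval 0‖ := by field_simp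
        _ ≤ _ := by
          gcongr
          exact hPhiHge _
    have h := intermediate_value_Icc (a := (0:ℝ)) (b := s / ‖Q.derivative.eval 0‖)
      (by positivity) hcont.continuousOn
    obtain ⟨r, hr, hrs⟩ := h (show s ∈ _ from ⟨by simpa using hs.le, hb⟩)
    refine ⟨r, lt_of_le_of_ne hr.1 ?_, hrs⟩
    rintro rfl
    simp at hrs
    exact hs.ne hrs
  have hPQ : Phi Q r = s := by rw [hPhi r hr, hrs]
  have hPhiHpos : 0 < Phi H r := ha.trans_le (hPhiHge r)
  have hkey : lam K d * Aprod H.roots r ≤ Aprod Q.derivative.roots r := by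
    have h := deriv_Phi Q hr hdeg.le h0
    rw [hPhi r hr, hPhiH, Phi_eq _ h1] at h
    have : (r * ‖Q.derivative.eval 0‖) * (lam K d * Aprod H.roots r) ≤
      (r * ‖Q.derivative.eval 0‖) * Aprod Q.derivative.roots r := by linarith
    exact le_of_mul_le_mul_left this (by positivity)
  have hseq : s = ‖Q.derivative.eval 0‖ * r * Aprod H.roots r := by
    rw [← hrs, hPhiH]; ring
  refine ⟨r, hr, ?_, ?_, ?_⟩
  · intro z hz
    have : ‖Q.eval z‖ = ‖z‖ * ‖H.eval z‖ := by rw [hH]; simp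
    rw [this, ← hrs]
    calc ‖z‖ * ‖H.eval z‖ ≤ ‖z‖ * Phi H r := by
          gcongr; exact eval_le_Phi H hz.le
      _ < r * Phi H r := by gcongr
  · intro hc
    have hQ'0 : Q.derivative ≠ 0 := by intro h; rw [h] at h1; simp at h1
    have hQ'r : ∀ w ∈ Q.derivative.roots, w ≠ 0 := by
      rintro w hw rfl
      exact h1 (mem_roots'.1 hw).2
    have hle : (Q.derivative.roots + H.roots.dedup).filter (fun w => ‖w‖ < r) ≤
        H.roots.filter (fun w => ‖w‖ < r) := by
      rw [Multiset.le_iff_count]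
      intro w
      by_cases hw : ‖w‖ < r
      · rw [Multiset.count_filter_of_pos (p := fun w : K => ‖w‖ < r) hw,
          Multiset.count_filter_of_pos (p := fun w : K => ‖w‖ < r) hw, Multiset.count_add]
        by_cases hwH : w ∈ H.roots
        · rw [Multiset.count_eq_one_of_mem (Multiset.nodup_dedup _) (Multiset.mem_dedup.2 hwH)]
          have hw0 : w ≠ 0 := hHr w hwH
          have hc1 : H.roots.count w = Q.roots.count w := by
            rw [hroots, Multiset.count_add, Multiset.count_singleton, if_neg hw0, zero_add]
          rw [hc1, count_roots, count_roots]
          have hQw : Q.IsRoot w := by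
            have := (mem_roots'.1 hwH).2
            rw [hH]; simp only [IsRoot, eval_mul] at *; rw [this, mul_zero]
          have hpos : 0 < Q.rootMultiplicity w := (rootMultiplicity_pos hQ0).2 hQw
          have hled : Q.rootMultiplicity w ≤ d := by
            rw [← count_roots, ← hdeg]
            exact (Multiset.count_le_card _ _).trans (card_roots' Q)
          have hnz : (Q.rootMultiplicity w : K) ≠ 0 := by
            intro h
            have := lam_le (K := K) hpos hled
            rw [h, norm_zero] at this
            linarith
          rw [derivative_rootMultiplicity_of_root_of_mem_nonZeroDivisors hQw
            (mem_nonZeroDivisors_of_ne_zero hnz)]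
          omega
        · have h2 : w ∉ Q.derivative.roots := by
            intro h2
            have h3 := (mem_roots'.1 h2).2
            have h4 := hc w hw h3
            have h5 : w ∈ Q.roots := mem_roots'.2 ⟨hQ0, h4⟩
            rw [hroots, Multiset.mem_add, Multiset.mem_singleton] at h5
            rcases h5 with h5 | h5
            · exact hQ'r w h2 h5
            · exact hwH h5
          rw [Multiset.count_eq_zero_of_notMem h2,
            Multiset.count_eq_zero_of_notMem (fun h => hwH (Multiset.mem_dedup.1 h))]
          simp
      · rw [Multiset.count_filter_of_neg (p := fun w : K => ‖w‖ < r) hw]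
        exact Nat.zero_le _
    have hW : ∀ w ∈ H.roots.dedup, w ≠ 0 := fun w hw => hHr w (Multiset.mem_dedup.1 hw)
    have h2 := Aprod_mono hle hHr
    rw [Aprod_add] at h2
    have hW1 := Aprod_one_le _ hW r
    have hA1 := Aprod_one_le _ hHr r
    have hAW : lam K d * Aprod H.roots.dedup r ≤ 1 := by
      have : Aprod H.roots r * (lam K d * Aprod H.roots.dedup r) ≤ Aprod H.roots r * 1 := by
        calc _ = (lam K d * Aprod H.roots r) * Aprod H.roots.dedup r := by ring
          _ ≤ Aprod Q.derivative.roots r * Aprod H.roots.dedup r := by gcongr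
          _ ≤ _ := by linarith
      exact le_of_mul_le_mul_left this (by linarith)
    constructor
    · intro w hw0 hwr hQw
      have hwH : w ∈ H.roots := by
        have h5 : w ∈ Q.roots := mem_roots'.2 ⟨hQ0, hQw⟩
        rw [hroots, Multiset.mem_add, Multiset.mem_singleton] at h5
        exact h5.resolve_left hw0
      have hwp : 0 < ‖w‖ := norm_pos_iff.2 hw0
      have h3 : Aprod {w} r ≤ Aprod H.roots.dedup r := by
        apply Aprod_mono _ hW
        apply Multiset.filter_le_filter
        exact Multiset.singleton_le.2 (Multiset.mem_dedup.2 hwH)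
      have h4 : Aprod {w} r = r / ‖w‖ := by
        unfold Aprod
        rw [Multiset.filter_singleton, if_pos hwr]; simp
      rw [h4] at h3
      have h5 : lam K d * (r / ‖w‖) ≤ 1 := le_trans (by gcongr) hAW
      rw [← mul_div_assoc, div_le_one hwp] at h5
      exact h5
    · have h3 : Aprod H.roots r ≤ Aprod H.roots.dedup r ^ (d - 1) := by
        rw [← Aprod_nsmul]
        apply Aprod_mono
        · apply Multiset.filter_le_filter
          rw [Multiset.le_iff_count]
          intro w
          rw [Multiset.count_nsmul]
          by_cases hwH : w ∈ H.roots
          · rw [Multiset.count_eq_one_of_mem (Multiset.nodup_dedup _) (Multiset.mem_dedup.2 hwH),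
              mul_one, ← hHdeg]
            exact (Multiset.count_le_card _ _).trans (card_roots' H)
          · rw [Multiset.count_eq_zero_of_notMem hwH]; exact Nat.zero_le _
        · intro w hw
          exact hW w (Multiset.mem_of_mem_nsmul hw)
      rw [hseq]
      have h4 : lam K d ^ (d-1) * Aprod H.roots r ≤ 1 := by
        calc _ ≤ lam K d ^ (d-1) * Aprod H.roots.dedup r ^ (d - 1) := by gcongr
          _ = (lam K d * Aprod H.roots.dedup r) ^ (d-1) := by rw [mul_pow]
          _ ≤ 1 := pow_le_one₀ (by positivity) hAW
      calc _ = ‖Q.derivative.eval 0‖ * r * (lam K d ^ (d-1) * Aprod H.roots r) := by ring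
        _ ≤ ‖Q.derivative.eval 0‖ * r * 1 := by gcongr
        _ = _ := mul_one _
  · intro hc
    have h2 : Aprod Q.derivative.roots r = 1 := by
      unfold Aprod
      rw [Multiset.filter_eq_nil.2]
      · simp
      · intro w hw hwr
        exact hc w hwr (mem_roots'.1 hw).2
    rw [h2] at hkey
    rw [hseq]
    calc _ = ‖Q.derivative.eval 0‖ * r * (lam K d * Aprod H.roots r) := by ring
      _ ≤ ‖Q.derivative.eval 0‖ * r * 1 := by gcongr
      _ = _ := mul_one _

/-- the uncentered version -/
theorem step1 (P : K[X]) (d : ℕ) (hd : 2 ≤ d) (hdeg : P.natDegree = d) (a : K)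
    (h1 : P.derivative.eval a ≠ 0) (hlam : 0 < lam K d) {s : ℝ} (hs : 0 < s) :
    ∃ r : ℝ, 0 < r ∧ (∀ z, ‖z - a‖ < r → ‖P.eval z - P.eval a‖ < s) ∧
      ((∀ c, ‖c - a‖ < r → P.derivative.eval c = 0 → P.eval c = P.eval a) →
        (∀ w, w ≠ a → ‖w - a‖ < r → P.eval w = P.eval a → lam K d * r ≤ ‖w - a‖) ∧
        lam K d ^ (d - 1) * s ≤ ‖P.derivative.eval a‖ * r) ∧
      ((∀ c, ‖c - a‖ < r → P.derivative.eval c ≠ 0) →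
        lam K d * s ≤ ‖P.derivative.eval a‖ * r) := by
  set Q : K[X] := P.comp (X + C a) - C (P.eval a) with hQ
  have hQe : ∀ z, Q.eval z = P.eval (z + a) - P.eval a := by intro z; simp [hQ]
  have hQd : ∀ z, Q.derivative.eval z = P.derivative.eval (z + a) := by
    intro z; simp [hQ, derivative_comp]
  have hQdeg : Q.natDegree = d := by
    rw [hQ, natDegree_sub_C, natDegree_comp, natDegree_X_add_C, mul_one, hdeg]
  obtain ⟨r, hr, h2, h3, h4⟩ := step0 Q d hd hQdeg (by rw [hQe]; simp)
    (by rw [hQd]; simpa using h1) hlam hs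
  simp only [hQe, hQd, zero_add] at h2 h3 h4
  refine ⟨r, hr, ?_, ?_, ?_⟩
  · intro z hz
    simpa using h2 (z - a) hz
  · intro hc
    obtain ⟨h5, h6⟩ := h3 (fun c hcr hc' => sub_eq_zero.2 (hc (c + a) (by simpa using hcr) hc'))
    refine ⟨fun w hw hwr hwe => ?_, h6⟩
    exact h5 (w - a) (sub_ne_zero.2 hw) hwr (by simpa using sub_eq_zero.2 hwe)
  · intro hc
    exact h4 (fun c hcr => hc (c + a) (by simpa using hcr))

/-- the orbit -/
def Orb (P : K[X]) (z0 : K) : Set K := Set.range fun i : ℕ => (fun z => P.eval z)^[i] z0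

/-- postcritical points landing on the orbit but not yet in it -/
def PC (P : K[X]) (z0 : K) : Set K :=
  {x | ∃ c, P.derivative.eval c = 0 ∧ (∃ k : ℕ, x = (fun z => P.eval z)^[k] c) ∧ x ∉ Orb P z0 ∧
    ∃ j : ℕ, (fun z => P.eval z)^[j] c ∈ Orb P z0}

/-- good disks -/
def GoodD (P : K[X]) (z0 y : K) (s : ℝ) : Prop :=
  0 < s ∧ (∀ x, ‖x - y‖ < s →
    Tendsto (fun k : ℕ => (fun z => P.eval z)^[k] x - (fun z => P.eval z)^[k] y) atTop (nhds 0)) ∧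
  (∀ x, ‖x - y‖ < s → x ∉ PC P z0)

/-- bad points of the cycle -/
def BadP (P : K[X]) (z0 y : K) : Prop :=
  ∃ c, P.derivative.eval c = 0 ∧ ∃ k : ℕ, (fun z => P.eval z)^[k] c ∉ Orb P z0 ∧
    (fun z => P.eval z)^[k + 1] c = P.eval y

theorem orb_iter {P : K[X]} {z0 y : K} (hy : y ∈ Orb P z0) (k : ℕ) :
    (fun z => P.eval z)^[k] y ∈ Orb P z0 := by
  obtain ⟨i, rfl⟩ := hy
  exact ⟨k + i, Function.iterate_add_apply _ k i z0⟩

theorem orb_eval {P : K[X]} {z0 y : K} (hy : y ∈ Orb P z0) : P.eval y ∈ Orb P z0 :=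
  orb_iter hy 1

theorem orb_mono {P : K[X]} {z0 c : K} {j k : ℕ} (h : (fun z => P.eval z)^[j] c ∈ Orb P z0)
    (hjk : j ≤ k) : (fun z => P.eval z)^[k] c ∈ Orb P z0 := by
  obtain ⟨m, rfl⟩ := Nat.exists_eq_add_of_le hjk
  rw [add_comm, Function.iterate_add_apply]
  exact orb_iter h m

theorem orb_per {P : K[X]} {z0 y : K} {N : ℕ} (hper : (fun z => P.eval z)^[N] z0 = z0)
    (hy : y ∈ Orb P z0) : (fun z => P.eval z)^[N] y = y := by
  obtain ⟨i, rfl⟩ := hy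
  simp only
  rw [← Function.iterate_add_apply, add_comm, Function.iterate_add_apply, hper]

theorem orb_per_mul {P : K[X]} {z0 y : K} {N : ℕ} (hper : (fun z => P.eval z)^[N] z0 = z0)
    (hy : y ∈ Orb P z0) (n : ℕ) : (fun z => P.eval z)^[n * N] y = y := by
  rw [mul_comm, Function.iterate_mul]
  exact Function.iterate_fixed (orb_per hper hy) n

theorem orb_inj {P : K[X]} {z0 y y' : K} {N : ℕ} (hN : 0 < N)
    (hper : (fun z => P.eval z)^[N] z0 = z0)
    (hy : y ∈ Orb P z0) (hy' : y' ∈ Orb P z0) (h : P.eval y = P.eval y') : y = y' := by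
  obtain ⟨M, rfl⟩ := Nat.exists_eq_succ_of_ne_zero hN.ne'
  have h1 := orb_per hper hy
  have h2 := orb_per hper hy'
  rw [Function.iterate_succ_apply] at h1 h2
  rw [← h1, ← h2]
  simp only [h]

theorem orb_exists {P : K[X]} {z0 y : K} {N : ℕ} (hN : 0 < N)
    (hper : (fun z => P.eval z)^[N] z0 = z0) (hy : y ∈ Orb P z0) :
    ∃ i < N, y = (fun z => P.eval z)^[i] z0 := by
  obtain ⟨i, rfl⟩ := hy
  refine ⟨i % N, Nat.mod_lt _ hN, ?_⟩
  have : Function.IsPeriodicPt (fun z => P.eval z) N z0 := hper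
  exact (this.iterate_mod_apply i).symm

theorem mulN_tendsto {N : ℕ} (hN : 0 < N) (e : ℕ) :
    Tendsto (fun n : ℕ => n * N + e) atTop atTop := by
  apply tendsto_atTop_mono (f := fun n : ℕ => n) _ tendsto_id
  intro n
  nlinarith

/-- two aligned points of the orbit coincide -/
theorem orb_align {P : K[X]} {z0 y y' : K} {N : ℕ} (hN : 0 < N)
    (hper : (fun z => P.eval z)^[N] z0 = z0)
    (hy : y ∈ Orb P z0) (hy' : (fun z => P.eval z)^[N] y' = y')
    (h : Tendsto (fun k : ℕ => (fun z => P.eval z)^[k] y' - (fun z => P.eval z)^[k] y)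
      atTop (nhds 0)) : y' = y := by
  have h1 := h.comp (mulN_tendsto hN 0)
  have h2 : (fun k : ℕ => (fun z => P.eval z)^[k] y' - (fun z => P.eval z)^[k] y) ∘
      (fun n : ℕ => n * N + 0) = fun _ => y' - y := by
    funext n
    simp only [Function.comp, add_zero]
    rw [orb_per_mul hper hy, mul_comm, Function.iterate_mul, Function.iterate_fixed hy']
  rw [h2] at h1
  exact sub_eq_zero.1 (tendsto_nhds_unique tendsto_const_nhds h1)

theorem land {P : K[X]} {z0 y c : K} {N k : ℕ} (hN : 0 < N)
    (hper : (fun z => P.eval z)^[N] z0 = z0) (hy : y ∈ Orb P z0)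
    (h : Tendsto (fun j : ℕ => (fun z => P.eval z)^[j] ((fun z => P.eval z)^[k] c) -
      (fun z => P.eval z)^[j] y) atTop (nhds 0)) :
    (∃ i < N, Tendsto (fun n => (fun z => P.eval z)^[n * N] c) atTop
          (nhds ((fun z => P.eval z)^[i] z0))) ∧
    (¬ Function.Injective (fun n : ℕ => (fun z => P.eval z)^[n] c) →
      ∃ j : ℕ, (fun z => P.eval z)^[j] c ∈ Orb P z0) := by
  set F : K → K := fun z => P.eval z with hF
  set y' := F^[k * N - k] y with hy'
  have hy'O : y' ∈ Orb P z0 := orb_iter hy _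
  have hkN : k ≤ k * N := Nat.le_mul_of_pos_right k hN
  have hT : Tendsto (fun n => F^[(n + k) * N] c) atTop (nhds y') := by
    have h1 := h.comp (mulN_tendsto hN (k * N - k))
    have h2 : (fun j : ℕ => F^[j] (F^[k] c) - F^[j] y) ∘ (fun n : ℕ => n * N + (k * N - k)) =
        fun n => F^[(n + k) * N] c - y' := by
      funext n
      simp only [Function.comp]
      rw [← Function.iterate_add_apply, Function.iterate_add_apply F (n * N) (k * N - k) y, ← hy',
        orb_per_mul hper hy'O]
      congr 2
      rw [add_mul]; omega
    rw [h2] at h1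
    simpa using h1.add_const y'
  constructor
  · obtain ⟨i, hi, hyi⟩ := orb_exists hN hper hy'O
    refine ⟨i, hi, ?_⟩
    rw [show F^[i] z0 = y' from hyi.symm]
    exact (tendsto_add_atTop_iff_nat (f := fun n => F^[n * N] c) k).1 hT
  · intro hinj
    obtain ⟨a, b, hab, hlt⟩ : ∃ a b, F^[a] c = F^[b] c ∧ a < b := by
      simp only [Function.Injective] at hinj
      push Not at hinj
      obtain ⟨a, b, hab, hne⟩ := hinj
      rcases lt_or_gt_of_ne hne with h | h
      · exact ⟨a, b, hab, h⟩
      · exact ⟨b, a, hab.symm, h⟩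
    obtain ⟨D, rfl⟩ := Nat.exists_eq_add_of_lt hlt
    have hrep : ∀ t : ℕ, F^[t * (D + 1) + a] c = F^[a] c := by
      intro t
      induction t with
      | zero => simp
      | succ t ih =>
        have : (t + 1) * (D + 1) + a = t * (D + 1) + (a + D + 1) := by ring
        rw [this, Function.iterate_add_apply, ← hab, ← Function.iterate_add_apply, ih]
    refine ⟨(a + k) * N, ?_⟩
    have hsub : Tendsto (fun t : ℕ => t * (D + 1) + a) atTop atTop :=
      mulN_tendsto (Nat.succ_pos D) a
    have h1 := hT.comp hsub
    have h2 : (fun n => F^[(n + k) * N] c) ∘ (fun t : ℕ => t * (D + 1) + a) =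
        fun _ => F^[(a + k) * N] c := by
      funext t
      simp only [Function.comp]
      have haN : a ≤ (a + k) * N := by nlinarith
      have e1 : (t * (D + 1) + a + k) * N = ((a + k) * N - a) + ((t * N) * (D + 1) + a) := by
        have : (t * (D + 1) + a + k) * N = (a + k) * N + (t * N) * (D + 1) := by ring
        omega
      have e2 : (a + k) * N = ((a + k) * N - a) + a := by omega
      rw [e1, Function.iterate_add_apply, hrep, ← Function.iterate_add_apply, ← e2]
    rw [h2] at h1
    rw [tendsto_nhds_unique tendsto_const_nhds h1]
    exact hy'O

theorem deriv_iter (P : K[X]) (z0 : K) (m : ℕ) :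
    HasDerivAt ((fun z => P.eval z)^[m])
      (∏ i ∈ Finset.range m, P.derivative.eval ((fun z => P.eval z)^[i] z0)) z0 := by
  induction m with
  | zero => simpa using hasDerivAt_id z0
  | succ m ih =>
    rw [Function.iterate_succ', Finset.prod_range_succ, mul_comm]
    exact (P.hasDerivAt _).comp z0 ih

theorem good_init {P : K[X]} {z0 : K} {N : ℕ} (hN : 0 < N)
    (hper : (fun z => P.eval z)^[N] z0 = z0) {L : K} (hL : L ≠ 0) (hL1 : ‖L‖ < 1)
    (hd : HasDerivAt ((fun z => P.eval z)^[N]) L z0) : ∃ s, GoodD P z0 z0 s := by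
  set F : K → K := fun z => P.eval z with hF
  have hLp : 0 < ‖L‖ := norm_pos_iff.2 hL
  have h1 := (hasDerivAt_iff_isLittleO.1 hd).def (half_pos hLp)
  obtain ⟨s, hs, hball⟩ := Metric.eventually_nhds_iff.1 h1
  have hG : ∀ x, ‖x - z0‖ < s → ‖F^[N] x - z0‖ = ‖L‖ * ‖x - z0‖ := by
    intro x hx
    by_cases hxz : x = z0
    · subst hxz; rw [hper]; simp
    have h2 := hball (y := x) (by rwa [dist_eq_norm])
    rw [hper] at h2
    have hxp : 0 < ‖x - z0‖ := norm_pos_iff.2 (sub_ne_zero.2 hxz)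
    have h3 : ‖(x - z0) • L‖ = ‖L‖ * ‖x - z0‖ := by rw [norm_smul, mul_comm]
    have hpos : 0 < ‖L‖ * ‖x - z0‖ := by positivity
    have h4 : ‖F^[N] x - z0 - (x - z0) • L‖ < ‖(x - z0) • L‖ := by rw [h3]; linarith
    have h5 := IsUltrametricDist.norm_add_eq_max_of_norm_ne_norm h4.ne
    rw [sub_add_cancel, max_eq_right h4.le, h3] at h5
    exact h5
  have hGn : ∀ x, ‖x - z0‖ < s → ∀ n : ℕ, ‖F^[n * N] x - z0‖ = ‖L‖ ^ n * ‖x - z0‖ := by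
    intro x hx n
    induction n with
    | zero => simp
    | succ n ih =>
      have hle : ‖L‖ ^ n * ‖x - z0‖ ≤ ‖x - z0‖ :=
        mul_le_of_le_one_left (norm_nonneg _) (pow_le_one₀ hLp.le hL1.le)
      rw [add_mul, one_mul, add_comm, Function.iterate_add_apply, hG _ (by rw [ih]; linarith), ih]
      ring
  refine ⟨s, hs, ?_, ?_⟩
  · intro x hx
    have hlim : Tendsto (fun n : ℕ => F^[n * N] x) atTop (nhds z0) := by
      rw [tendsto_iff_norm_sub_tendsto_zero]
      simp only [hGn x hx]
      simpa using (tendsto_pow_atTop_nhds_zero_of_lt_one hLp.le hL1).mul_const ‖x - z0‖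
    have hFc : Continuous F := P.continuous
    rw [Metric.tendsto_atTop]
    intro ε hε
    have hev : ∀ᶠ n : ℕ in atTop, ∀ j ∈ Finset.range N,
        dist (F^[j] (F^[n * N] x)) (F^[j] z0) < ε := by
      rw [Filter.eventually_all_finset]
      intro j _
      have := ((hFc.iterate j).tendsto z0).comp hlim
      exact (Metric.tendsto_nhds.1 this) ε hε
    obtain ⟨n0, hn0⟩ := eventually_atTop.1 hev
    refine ⟨n0 * N, fun k hk => ?_⟩
    have h2 := hn0 (k / N) ((Nat.le_div_iff_mul_le hN).2 hk) (k % N)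
      (Finset.mem_range.2 (Nat.mod_lt _ hN))
    have e : k % N + k / N * N = k := Nat.mod_add_div' k N
    have hz : F^[k % N] z0 = F^[k] z0 := by
      have : Function.IsPeriodicPt F N z0 := hper
      exact this.iterate_mod_apply k
    rw [← Function.iterate_add_apply, e, hz, dist_eq_norm] at h2
    rw [dist_eq_norm, sub_zero]
    exact h2
  · rintro x hx ⟨c, hc, ⟨k, hk⟩, hxO, j, hj⟩
    have h2 : F^[j * N] x ∈ Orb P z0 := by
      rw [hk, ← Function.iterate_add_apply]
      have : j ≤ j * N := Nat.le_mul_of_pos_right j hN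
      exact orb_mono hj (by omega)
    have h3 := orb_per hper h2
    have h4 := hGn x hx j
    have h5 := hGn x hx (j + 1)
    rw [add_mul, one_mul, add_comm, Function.iterate_add_apply, h3, h4, pow_succ] at h5
    have h6 : ‖L‖ ^ j * (1 - ‖L‖) * ‖x - z0‖ = 0 := by linarith
    have h7 : ‖L‖ ^ j * (1 - ‖L‖) ≠ 0 := by
      apply mul_ne_zero (pow_ne_zero _ hLp.ne'); linarith
    have h8 := (mul_eq_zero.1 h6).resolve_left h7
    rw [norm_eq_zero, sub_eq_zero] at h8
    exact hxO (h8 ▸ ⟨0, rfl⟩)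

open Classical in
theorem good_step {P : K[X]} {d : ℕ} (hd : 2 ≤ d) (hdeg : P.natDegree = d)
    (hlam : 0 < lam K d) {z0 y : K} {N : ℕ} (hN : 0 < N)
    (hper : (fun z => P.eval z)^[N] z0 = z0) (hy : y ∈ Orb P z0)
    (hPy : P.derivative.eval y ≠ 0)
    (hneg : ∀ c, P.derivative.eval c = 0 → (∃ i < N,
        Tendsto (fun n => (fun z => P.eval z)^[n * N] c) atTop
          (nhds ((fun z => P.eval z)^[i] z0))) →
        ¬ Function.Injective (fun n : ℕ => (fun z => P.eval z)^[n] c))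
    {s' : ℝ} (hg : GoodD P z0 (P.eval y) s') :
    ∃ s, GoodD P z0 y s ∧
      lam K d ^ (if BadP P z0 y then d else 1) * s' ≤ ‖P.derivative.eval y‖ * s := by
  obtain ⟨hs', hg1, hg2⟩ := hg
  obtain ⟨r, hr, h2, h3, h4⟩ := step1 P d hd hdeg y hPy hlam hs'
  have hyO := orb_eval hy
  -- points of critical orbits
  have hkey : ∀ c, P.derivative.eval c = 0 → ∀ k : ℕ,
      ‖(fun z => P.eval z)^[k] c - y‖ < r → (fun z => P.eval z)^[k + 1] c = P.eval y := by
    intro c hc k hk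
    have h5 := h2 _ hk
    rw [show P.eval ((fun z => P.eval z)^[k] c) = (fun z => P.eval z)^[k + 1] c from
      (Function.iterate_succ_apply' (fun z => P.eval z) k c).symm] at h5
    have h6 := hg1 _ h5
    obtain ⟨h7, h8⟩ := land hN hper hyO h6
    have h9 := h8 (hneg c hc h7)
    have h10 : (fun z => P.eval z)^[k + 1] c ∈ Orb P z0 := by
      by_contra h
      exact hg2 _ h5 ⟨c, hc, ⟨k + 1, rfl⟩, h, h9⟩
    exact orb_align hN hper hyO (orb_per hper h10) h6
  have hatt : ∀ x, ‖x - y‖ < r →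
      Tendsto (fun k : ℕ => (fun z => P.eval z)^[k] x - (fun z => P.eval z)^[k] y)
        atTop (nhds 0) := by
    intro x hx
    have h5 := hg1 _ (h2 x hx)
    exact (tendsto_add_atTop_iff_nat (f := fun k : ℕ =>
      (fun z => P.eval z)^[k] x - (fun z => P.eval z)^[k] y) 1).1 h5
  have hl1 : lam K d ≤ 1 := lam_le_one (by omega)
  by_cases hb : BadP P z0 y
  · rw [if_pos hb]
    obtain ⟨h5, h6⟩ := h3 (fun c hcr hc => hkey c hc 0 hcr)
    have hlr : lam K d * r ≤ r := mul_le_of_le_one_left hr.le hl1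
    refine ⟨lam K d * r, ⟨by positivity, fun x hx => hatt x (hx.trans_le hlr), ?_⟩, ?_⟩
    · rintro x hx ⟨c, hc, ⟨k, rfl⟩, hxO, _⟩
      have h7 := hkey c hc k (hx.trans_le hlr)
      rw [Function.iterate_succ_apply'] at h7
      have h8 := h5 _ (fun h => hxO (by rw [h]; exact hy)) (hx.trans_le hlr) h7
      linarith
    · obtain ⟨e, rfl⟩ : ∃ e, d = e + 1 := ⟨d - 1, by omega⟩
      rw [Nat.add_sub_cancel] at h6
      rw [pow_succ]
      calc _ = lam K (e + 1) * (lam K (e + 1) ^ e * s') := by ring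
        _ ≤ lam K (e + 1) * (‖P.derivative.eval y‖ * r) := by gcongr
        _ = _ := by ring
  · rw [if_neg hb, pow_one]
    refine ⟨r, ⟨hr, hatt, ?_⟩, h4 ?_⟩
    · rintro x hx ⟨c, hc, ⟨k, rfl⟩, hxO, _⟩
      exact hb ⟨c, hc, k, hxO, hkey c hc k hx⟩
    · intro c hcr hc
      have h5 := hkey c hc 0 hcr
      refine hb ⟨c, hc, 0, ?_, h5⟩
      intro hcO
      have : c = y := orb_inj hN hper hcO hy h5
      exact hPy (this ▸ hc)

open Classical in
theorem bad_card {P : K[X]} {d : ℕ} (hdeg : P.natDegree = d) (hP' : P.derivative ≠ 0) {z0 : K}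
    {N : ℕ} (hN : 0 < N) (hper : (fun z => P.eval z)^[N] z0 = z0)
    (hmin : ∀ m : ℕ, 0 < m → m < N → (fun z => P.eval z)^[m] z0 ≠ z0) :
    ((Finset.range N).filter (fun i => BadP P z0 ((fun z => P.eval z)^[i] z0))).card ≤ d - 1 := by
  have hcard : P.derivative.roots.toFinset.card ≤ d - 1 :=
    (Multiset.toFinset_card_le _).trans ((card_roots' _).trans
      ((natDegree_derivative_le P).trans (by rw [hdeg])))
  refine le_trans ?_ hcard
  have hch : ∀ i, ∃ c, BadP P z0 ((fun z => P.eval z)^[i] z0) → P.derivative.eval c = 0 ∧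
      ∃ k : ℕ, (fun z => P.eval z)^[k] c ∉ Orb P z0 ∧
    (fun z => P.eval z)^[k + 1] c = P.eval ((fun z => P.eval z)^[i] z0) := by
    intro i
    by_cases hb : BadP P z0 ((fun z => P.eval z)^[i] z0)
    · obtain ⟨c, hc⟩ := hb
      exact ⟨c, fun _ => hc⟩
    · exact ⟨0, fun h => absurd h hb⟩
  choose f hf using hch
  apply Finset.card_le_card_of_injOn f
  · intro i hi
    have hb := (Finset.mem_filter.1 hi).2
    simp only [Finset.mem_coe, Multiset.mem_toFinset]
    exact mem_roots'.2 ⟨hP', (hf i hb).1⟩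
  · intro i hi j hj hij
    have hi := Finset.mem_filter.1 hi
    have hj := Finset.mem_filter.1 hj
    obtain ⟨-, k, hk1, hk2⟩ := hf i hi.2
    obtain ⟨-, l, hl1, hl2⟩ := hf j hj.2
    rw [← hij] at hl1 hl2
    have oi : (fun z => P.eval z)^[i] z0 ∈ Orb P z0 := ⟨i, rfl⟩
    have oj : (fun z => P.eval z)^[j] z0 ∈ Orb P z0 := ⟨j, rfl⟩
    have hk3 : (fun z => P.eval z)^[k + 1] (f i) ∈ Orb P z0 := by rw [hk2]; exact orb_eval oi
    have hl3 : (fun z => P.eval z)^[l + 1] (f i) ∈ Orb P z0 := by rw [hl2]; exact orb_eval oj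
    have hkl : k = l := by
      rcases lt_trichotomy k l with h | h | h
      · exact absurd (orb_mono hk3 h) hl1
      · exact h
      · exact absurd (orb_mono hl3 h) hk1
    subst hkl
    have heq := orb_inj hN hper oi oj (hk2.symm.trans hl2)
    have hiN := Finset.mem_range.1 hi.1
    have hjN := Finset.mem_range.1 hj.1
    have aux : ∀ i j, i < N → j < N → i < j →
        (fun z => P.eval z)^[i] z0 = (fun z => P.eval z)^[j] z0 → False := by
      intro i j hi hj hlt h
      have h1 := congrArg ((fun z => P.eval z)^[N - j]) h
      rw [← Function.iterate_add_apply, ← Function.iterate_add_apply,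
        Nat.sub_add_cancel hj.le, hper] at h1
      exact hmin _ (by omega) (by omega) h1
    rcases lt_trichotomy i j with h | h | h
    · exact (aux i j hiN hjN h heq).elim
    · exact h
    · exact (aux j i hjN hiN h heq.symm).elim

theorem exists_fixed {P : K[X]} {d : ℕ} (hd : 2 ≤ d) (hdeg : P.natDegree = d) {z0 : K} {N : ℕ}
    {L : K} (hL : L = ∏ i ∈ Finset.range N, P.derivative.eval ((fun z => P.eval z)^[i] z0))
    (hL1 : ‖L‖ < 1) : ∃ x, x ≠ z0 ∧ P.eval x = x := by
  classical
  by_contra hcon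
  push Not at hcon
  have hdeg2 : (P - X).natDegree = d := by
    rw [natDegree_sub_eq_left_of_natDegree_lt (by rw [natDegree_X]; omega), hdeg]
  have hne : P - X ≠ 0 := by intro h; rw [h] at hdeg2; simp at hdeg2; omega
  have hroots : (P - X).roots = Multiset.replicate d z0 := by
    rw [Multiset.eq_replicate]
    constructor
    · rw [← hdeg2]; exact (IsAlgClosed.splits (P - X)).natDegree_eq_card_roots.symm
    · intro b hb
      have h1 := (mem_roots'.1 hb).2
      by_contra hb'
      apply hcon b hb'
      simpa [IsRoot, sub_eq_zero] using h1
  have hmem : z0 ∈ (P - X).roots := by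
    rw [hroots]; exact Multiset.mem_replicate.2 ⟨by omega, rfl⟩
  have hfix : P.eval z0 = z0 := by
    have := (mem_roots'.1 hmem).2
    simpa [IsRoot, sub_eq_zero] using this
  have hder : P.derivative.eval z0 = 1 := by
    have h1 : 1 < (P - X).rootMultiplicity z0 := by
      rw [← count_roots, hroots, Multiset.count_replicate_self]; omega
    have h2 := ((one_lt_rootMultiplicity_iff_isRoot hne).1 h1).2
    simpa [IsRoot, sub_eq_zero] using h2
  have hL' : L = 1 := by
    rw [hL]
    apply Finset.prod_eq_one
    intro i _
    rw [Function.iterate_fixed (show (fun z => P.eval z) z0 = z0 from hfix), hder]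
  rw [hL'] at hL1
  simp at hL1

open Classical in
theorem good_loop {P : K[X]} {d : ℕ} (hd : 2 ≤ d) (hdeg : P.natDegree = d)
    (hlam : 0 < lam K d) {z0 : K} {N : ℕ} (hN : 0 < N)
    (hper : (fun z => P.eval z)^[N] z0 = z0)
    (hP : ∀ y ∈ Orb P z0, P.derivative.eval y ≠ 0)
    (hneg : ∀ c, P.derivative.eval c = 0 → (∃ i < N,
        Tendsto (fun n => (fun z => P.eval z)^[n * N] c) atTop
          (nhds ((fun z => P.eval z)^[i] z0))) →
        ¬ Function.Injective (fun n : ℕ => (fun z => P.eval z)^[n] c)) (m : ℕ) :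
    ∀ s', GoodD P z0 ((fun z => P.eval z)^[m] z0) s' → ∃ s, GoodD P z0 z0 s ∧
      lam K d ^ (∑ i ∈ Finset.range m, if BadP P z0 ((fun z => P.eval z)^[i] z0) then d else 1)
        * s' ≤ ‖∏ i ∈ Finset.range m, P.derivative.eval ((fun z => P.eval z)^[i] z0)‖ * s := by
  induction m with
  | zero => intro s' h; exact ⟨s', h, by simp⟩
  | succ m ih =>
    intro s' h
    rw [Function.iterate_succ_apply'] at h
    have ho : (fun z => P.eval z)^[m] z0 ∈ Orb P z0 := ⟨m, rfl⟩
    obtain ⟨t, ht, hts⟩ := good_step hd hdeg hlam hN hper ho (hP _ ho) hneg h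
    obtain ⟨s, hs, hst⟩ := ih t ht
    refine ⟨s, hs, ?_⟩
    rw [Finset.sum_range_succ, Finset.prod_range_succ, pow_add, norm_mul]
    set A := lam K d ^ (∑ i ∈ Finset.range m,
      if BadP P z0 ((fun z => P.eval z)^[i] z0) then d else 1)
    set B := lam K d ^ (if BadP P z0 ((fun z => P.eval z)^[m] z0) then d else 1)
    set a := ‖P.derivative.eval ((fun z => P.eval z)^[m] z0)‖
    have hA : 0 ≤ A := by positivity
    have ha : 0 ≤ a := norm_nonneg _
    calc A * B * s' = A * (B * s') := by ring
      _ ≤ A * (a * t) := by gcongr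
      _ = a * (A * t) := by ring
      _ ≤ a * (_ * s) := by gcongr
      _ = _ := by ring

end one

theorem infinite_orbit_critical_point_attracted
    {K : Type*} [NontriviallyNormedField K] [IsAlgClosed K]
    [CompleteSpace K] [IsUltrametricDist K]
    (P : Polynomial K) (d : ℕ) (hd : 2 ≤ d) (hdeg : P.natDegree = d)
    (z0 : K) (N : ℕ) (hN : 0 < N)
    (hper : (fun z => P.eval z)^[N] z0 = z0)
    (hmin : ∀ m : ℕ, 0 < m → m < N → (fun z => P.eval z)^[m] z0 ≠ z0)
    (hne : (∏ i ∈ Finset.range N, P.derivative.eval ((fun z => P.eval z)^[i] z0)) ≠ 0)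
    (hlt :
      (N ≤ 2 * d - 2 ∧
        ‖∏ i ∈ Finset.range N, P.derivative.eval ((fun z => P.eval z)^[i] z0)‖ <
          lam K d ^ (d * N)) ∨
      (2 * d - 2 < N ∧
        ‖∏ i ∈ Finset.range N, P.derivative.eval ((fun z => P.eval z)^[i] z0)‖ <
          lam K d ^ (N + 2 * (d - 1) ^ 2))) :
    ∃ c : K, P.derivative.eval c = 0 ∧
      Function.Injective (fun n : ℕ => (fun z => P.eval z)^[n] c) ∧
      ∃ i < N,
        Tendsto (fun n => (fun z => P.eval z)^[n * N] c) atTop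
          (nhds ((fun z => P.eval z)^[i] z0)) := by
  classical
  by_contra hcon
  have hneg : ∀ c, P.derivative.eval c = 0 → (∃ i < N,
        Tendsto (fun n => (fun z => P.eval z)^[n * N] c) atTop
          (nhds ((fun z => P.eval z)^[i] z0))) →
        ¬ Function.Injective (fun n : ℕ => (fun z => P.eval z)^[n] c) :=
    fun c hc ht hi => hcon ⟨c, hc, hi, ht⟩
  obtain ⟨L, hL⟩ : ∃ L, L = ∏ i ∈ Finset.range N,
    P.derivative.eval ((fun z => P.eval z)^[i] z0) := ⟨_, rfl⟩
  have hP : ∀ y ∈ Orb P z0, P.derivative.eval y ≠ 0 := by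
    intro y hy
    obtain ⟨i, hi, rfl⟩ := orb_exists hN hper hy
    exact Finset.prod_ne_zero_iff.1 hne i (Finset.mem_range.2 hi)
  have hP' : P.derivative ≠ 0 := by
    intro h
    apply hP z0 ⟨0, rfl⟩
    rw [h, eval_zero]
  have hl1 : lam K d ≤ 1 := lam_le_one (by omega)
  have hl0 : 0 ≤ lam K d := lam_nonneg d
  have hlam : 0 < lam K d := by
    rcases hl0.lt_or_eq with h | h
    · exact h
    · exfalso
      rw [← h] at hlt
      rcases hlt with ⟨_, h2⟩ | ⟨_, h2⟩
      · rw [zero_pow (by positivity)] at h2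
        exact absurd h2 (not_lt.2 (norm_nonneg _))
      · rw [zero_pow (by omega)] at h2
        exact absurd h2 (not_lt.2 (norm_nonneg _))
  set E := ∑ i ∈ Finset.range N, if BadP P z0 ((fun z => P.eval z)^[i] z0) then d else 1 with hE
  set b := ((Finset.range N).filter (fun i => BadP P z0 ((fun z => P.eval z)^[i] z0))).card
    with hb
  have hbd : b ≤ d - 1 := bad_card hdeg hP' hN hper hmin
  have hEb : E = N + b * (d - 1) := by
    have h1 : ∀ i, (if BadP P z0 ((fun z => P.eval z)^[i] z0) then d else 1) =
        1 + if BadP P z0 ((fun z => P.eval z)^[i] z0) then (d - 1) else 0 := by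
      intro i; split_ifs <;> omega
    rw [hE, Finset.sum_congr rfl (fun i _ => h1 i), Finset.sum_add_distrib,
      ← Finset.sum_filter, Finset.sum_const, Finset.sum_const]
    simp [hb]
  have hbN : b ≤ N := by
    rw [hb]; exact (Finset.card_filter_le _ _).trans (by simp)
  rw [← hL] at hne hlt
  have hLE : ‖L‖ < lam K d ^ E := by
    rcases hlt with ⟨_, h2⟩ | ⟨_, h2⟩
    · apply h2.trans_le
      apply pow_le_pow_of_le_one hl0 hl1
      obtain ⟨e, rfl⟩ : ∃ e, d = e + 1 := ⟨d - 1, by omega⟩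
      rw [hEb, Nat.add_sub_cancel]
      nlinarith
    · apply h2.trans_le
      apply pow_le_pow_of_le_one hl0 hl1
      rw [hEb]
      nlinarith
  have hL1 : ‖L‖ < 1 := hLE.trans_le (pow_le_one₀ hl0 hl1)
  have hLp : 0 < ‖L‖ := norm_pos_iff.2 hne
  obtain ⟨s0, hs0⟩ := good_init hN hper hne hL1 (by rw [hL]; exact deriv_iter P z0 N)
  obtain ⟨x, hxz, hx⟩ := exists_fixed hd hdeg hL hL1
  have hbound : ∀ s, GoodD P z0 z0 s → s ≤ ‖x - z0‖ := by
    intro s hs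
    by_contra h
    push Not at h
    have h1 := hs.2.1 x h
    exact hxz (orb_align hN hper ⟨0, rfl⟩
      (Function.iterate_fixed (show (fun z => P.eval z) x = x from hx) N) h1)
  set κ := lam K d ^ E / ‖L‖ with hκ
  have hκ1 : 1 < κ := (one_lt_div hLp).2 hLE
  have hgrow : ∀ n : ℕ, ∃ s, GoodD P z0 z0 s ∧ κ ^ n * s0 ≤ s := by
    intro n
    induction n with
    | zero => exact ⟨s0, hs0, by simp⟩
    | succ n ih =>
      obtain ⟨s, hs, hsn⟩ := ih
      obtain ⟨t, ht, hts⟩ := good_loop hd hdeg hlam hN hper hP hneg N s (by rwa [hper])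
      refine ⟨t, ht, ?_⟩
      rw [← hL, ← hE] at hts
      have h1 : κ * s ≤ t := by
        rw [hκ, div_mul_eq_mul_div, div_le_iff₀ hLp]; linarith
      calc κ ^ (n + 1) * s0 = κ * (κ ^ n * s0) := by ring
        _ ≤ κ * s := by gcongr
        _ ≤ t := h1
  obtain ⟨n, hn⟩ := pow_unbounded_of_one_lt (‖x - z0‖ / s0) hκ1
  rw [div_lt_iff₀ hs0.1] at hn
  obtain ⟨s, hs, hsn⟩ := hgrow n
  have := hbound s hs
  linarith
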